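/- Let X and Y be real Banach spaces. The projective tensor product X ⊗̂_π Y has the Ball Dentable Property if and only if both X and Y have the Ball Dentable Property. -/

import Mathlib

set_option synthInstance.maxHeartbeats 1000000
set_option maxHeartbeats 1000000

open Metric Set Filter

noncomputable section

/-- A Banach space `Z` has the **Ball Dentable Property** (`BDP`) if its closed unit ball
has slices of arbitrarily small diameter. -/
def BallDentableProperty (Z : Type*) [NormedAddCommGroup Z] [NormedSpace ℝ Z] : Prop :=
  ∀ ε : ℝ, 0 < ε → ∃ (f : StrongDual ℝ Z) (α : ℝ), ‖f‖ = 1 ∧ 0 < α ∧ α < 1 ∧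
    Metric.diam {z : Z | ‖z‖ ≤ 1 ∧ 1 - α < f z} < ε

/-- The dual `Z*` of a Banach space `Z` has the **w*-Ball Dentable Property** (`w*-BDP`) if the
closed unit ball of `Z*` has weak-star slices (slices given by elements of the predual `Z`)
of arbitrarily small diameter. -/
def WStarBallDentableProperty (Z : Type*) [NormedAddCommGroup Z] [NormedSpace ℝ Z] : Prop :=
  ∀ ε : ℝ, 0 < ε → ∃ (z : Z) (α : ℝ), ‖z‖ = 1 ∧ 0 < α ∧ α < 1 ∧
    Metric.diam {f : StrongDual ℝ Z | ‖f‖ ≤ 1 ∧ 1 - α < f z} < ε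

/-- A Banach space `Z` has the **Ball Small Combination of Slices Property** (`BSCSP`) if its
closed unit ball has convex combinations of slices of arbitrarily small diameter. -/
def BallSCSProperty (Z : Type*) [NormedAddCommGroup Z] [NormedSpace ℝ Z] : Prop :=
  ∀ ε : ℝ, 0 < ε → ∃ (n : ℕ) (lam : Fin (n + 1) → ℝ) (f : Fin (n + 1) → StrongDual ℝ Z)
    (α : Fin (n + 1) → ℝ),
    (∀ i, 0 < lam i) ∧ (∑ i, lam i = 1) ∧ (∀ i, ‖f i‖ = 1) ∧ (∀ i, 0 < α i ∧ α i < 1) ∧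
    Metric.diam {z : Z | ∃ g : Fin (n + 1) → Z,
      (∀ i, ‖g i‖ ≤ 1 ∧ 1 - α i < f i (g i)) ∧ z = ∑ i, lam i • g i} < ε

/-- The dual `Z*` of a Banach space `Z` has the **w*-Ball Small Combination of Slices Property**
(`w*-BSCSP`) if the closed unit ball of `Z*` has convex combinations of weak-star slices
(slices given by elements of the predual `Z`) of arbitrarily small diameter. -/
def WStarBallSCSProperty (Z : Type*) [NormedAddCommGroup Z] [NormedSpace ℝ Z] : Prop :=
  ∀ ε : ℝ, 0 < ε → ∃ (n : ℕ) (lam : Fin (n + 1) → ℝ) (z : Fin (n + 1) → Z)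
    (α : Fin (n + 1) → ℝ),
    (∀ i, 0 < lam i) ∧ (∑ i, lam i = 1) ∧ (∀ i, ‖z i‖ = 1) ∧ (∀ i, 0 < α i ∧ α i < 1) ∧
    Metric.diam {φ : StrongDual ℝ Z | ∃ g : Fin (n + 1) → StrongDual ℝ Z,
      (∀ i, ‖g i‖ ≤ 1 ∧ 1 - α i < g i (z i)) ∧ φ = ∑ i, lam i • g i} < ε

/-- The roughness `η(Z, u)` of the norm of `Z` at `u`:
`limsup_{‖h‖ → 0} (‖u + h‖ + ‖u - h‖ - 2) / ‖h‖`. -/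
noncomputable def roughness (Z : Type*) [NormedAddCommGroup Z] (u : Z) : ℝ :=
  Filter.limsup (fun h : Z => (‖u + h‖ + ‖u - h‖ - 2) / ‖h‖) (nhdsWithin 0 {(0 : Z)}ᶜ)

/-- The norm of `Z` is **rough** if it is `ε`-rough for some `ε > 0`, i.e. there is `ε > 0`
with `η(Z, u) ≥ ε` for every `u` in the unit sphere of `Z`. -/
def RoughNorm (Z : Type*) [NormedAddCommGroup Z] : Prop :=
  ∃ ε : ℝ, 0 < ε ∧ ∀ u : Z, ‖u‖ = 1 → ε ≤ roughness Z u

/-- The norm of `Z` is **non-rough** if it is not rough. -/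
def NonRoughNorm (Z : Type*) [NormedAddCommGroup Z] : Prop := ¬ RoughNorm Z

/-- The rank-one operator `x* ⊗ y : E → F`, `x ↦ x*(x) • y`. -/
noncomputable def rankOneOp {E F : Type*} [NormedAddCommGroup E] [NormedSpace ℝ E]
    [NormedAddCommGroup F] [NormedSpace ℝ F] (f : StrongDual ℝ E) (y : F) : E →L[ℝ] F :=
  f.smulRight y

/-- For a subspace `H ⊆ L(E, F)`, a vector `x ∈ E` and a functional `g ∈ F*`, the functional
`x ⊗ g ∈ H*` given by `T ↦ g (T x)`. -/
noncomputable def dualTensorFunctional {E F : Type*} [NormedAddCommGroup E] [NormedSpace ℝ E]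
    [NormedAddCommGroup F] [NormedSpace ℝ F] (H : Submodule ℝ (E →L[ℝ] F)) (x : E)
    (g : StrongDual ℝ F) : StrongDual ℝ H :=
  g.comp ((ContinuousLinearMap.apply ℝ F x).comp H.subtypeL)

/-- The weak-star closed convex hull of a subset `S` of the dual `Z*`. -/
noncomputable def wStarClosedConvexHull (Z : Type*) [NormedAddCommGroup Z] [NormedSpace ℝ Z]
    (S : Set (StrongDual ℝ Z)) : Set (StrongDual ℝ Z) :=
  StrongDual.toWeakDual ⁻¹'
    closure (convexHull ℝ (StrongDual.toWeakDual '' S))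

/-- `D(Z, u)`: the set of norm-at-most-one functionals attaining the value `1` at `u`. -/
def dualFace (Z : Type*) [NormedAddCommGroup Z] [NormedSpace ℝ Z] (u : Z) :
    Set (StrongDual ℝ Z) := {h | ‖h‖ ≤ 1 ∧ h u = 1}

/-- `n(Z, u)`: the largest non-negative `k` such that
`k * ‖z‖ ≤ sup {|f z| : f ∈ D(Z, u)}` for every `z ∈ Z`. -/
noncomputable def nConstant (Z : Type*) [NormedAddCommGroup Z] [NormedSpace ℝ Z] (u : Z) : ℝ :=
  sSup {k : ℝ | 0 ≤ k ∧ ∀ z : Z, k * ‖z‖ ≤ ⨆ f : dualFace Z u, |f.1 z|}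

/-- The Banach space `B(X × Y)` of bounded bilinear forms on `X × Y`, realized as
`X →L[ℝ] Y →L[ℝ] ℝ`. -/
def BoundedBilinearForms (X Y : Type*) [NormedAddCommGroup X] [NormedSpace ℝ X]
    [NormedAddCommGroup Y] [NormedSpace ℝ Y] : Type _ :=
  X →L[ℝ] Y →L[ℝ] ℝ

noncomputable instance {X Y : Type*} [NormedAddCommGroup X] [NormedSpace ℝ X]
    [NormedAddCommGroup Y] [NormedSpace ℝ Y] : NormedAddCommGroup (BoundedBilinearForms X Y) :=
  inferInstanceAs (NormedAddCommGroup (X →L[ℝ] Y →L[ℝ] ℝ))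

noncomputable instance {X Y : Type*} [NormedAddCommGroup X] [NormedSpace ℝ X]
    [NormedAddCommGroup Y] [NormedSpace ℝ Y] : NormedSpace ℝ (BoundedBilinearForms X Y) :=
  inferInstanceAs (NormedSpace ℝ (X →L[ℝ] Y →L[ℝ] ℝ))

/-- The canonical image of the elementary tensor `x ⊗ y` in the dual of the space of bounded
bilinear forms on `X × Y`; it acts by `B ↦ B x y`. -/
noncomputable def projTensorElem {X Y : Type*} [NormedAddCommGroup X] [NormedSpace ℝ X]
    [NormedAddCommGroup Y] [NormedSpace ℝ Y] (x : X) (y : Y) :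
    StrongDual ℝ (BoundedBilinearForms X Y) :=
  (ContinuousLinearMap.apply ℝ ℝ y).comp (ContinuousLinearMap.apply ℝ (Y →L[ℝ] ℝ) x)

/-- The projective tensor product `X ⊗̂_π Y`, realized canonically (and isometrically) as the
closure of the span of the elementary tensors inside the dual of the Banach space of bounded
bilinear forms on `X × Y`.  (On elementary tensor combinations the dual norm coincides with the
projective norm, so this closed subspace is the canonical isometric copy of the completion
`X ⊗̂_π Y`.) -/
noncomputable def ProjectiveTensorProduct (X Y : Type*) [NormedAddCommGroup X] [NormedSpace ℝ X]
    [NormedAddCommGroup Y] [NormedSpace ℝ Y] :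
    Submodule ℝ (StrongDual ℝ (BoundedBilinearForms X Y)) :=
  (Submodule.span ℝ {φ | ∃ x y, φ = projTensorElem x y}).topologicalClosure

/-- The projective tensor product `X ⊗̂_π Y` as a Banach space. -/
def ProjectiveTensorSpace (X Y : Type*) [NormedAddCommGroup X] [NormedSpace ℝ X]
    [NormedAddCommGroup Y] [NormedSpace ℝ Y] : Type _ :=
  ↥(ProjectiveTensorProduct X Y)

noncomputable instance {X Y : Type*} [NormedAddCommGroup X] [NormedSpace ℝ X]
    [NormedAddCommGroup Y] [NormedSpace ℝ Y] : NormedAddCommGroup (ProjectiveTensorSpace X Y) :=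
  inferInstanceAs (NormedAddCommGroup ↥(ProjectiveTensorProduct X Y))

noncomputable instance {X Y : Type*} [NormedAddCommGroup X] [NormedSpace ℝ X]
    [NormedAddCommGroup Y] [NormedSpace ℝ Y] : NormedSpace ℝ (ProjectiveTensorSpace X Y) :=
  inferInstanceAs (NormedSpace ℝ ↥(ProjectiveTensorProduct X Y))

/-- The rank-one operator `x ⊗ y : X* → Y`, `x* ↦ x*(x) • y`. -/
noncomputable def injTensorElem {X Y : Type*} [NormedAddCommGroup X] [NormedSpace ℝ X]
    [NormedAddCommGroup Y] [NormedSpace ℝ Y] (x : X) (y : Y) :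
    StrongDual ℝ X →L[ℝ] Y :=
  (ContinuousLinearMap.apply ℝ ℝ x).smulRight y

/-- The injective tensor product `X ⊗̂_ε Y`, realized canonically (and isometrically) as the
closure of the span of the rank-one operators `x ⊗ y` inside the Banach space `L(X*, Y)`.
(On elementary tensor combinations the operator norm coincides with the injective norm, so this
closed subspace is the canonical isometric copy of the completion `X ⊗̂_ε Y`.) -/
noncomputable def InjectiveTensorProduct (X Y : Type*) [NormedAddCommGroup X] [NormedSpace ℝ X]
    [NormedAddCommGroup Y] [NormedSpace ℝ Y] :
    Submodule ℝ (StrongDual ℝ X →L[ℝ] Y) :=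
  haveI : ContinuousAdd (StrongDual ℝ X →L[ℝ] Y) :=
    ContinuousLinearMap.toNormedAddCommGroup.toSeminormedAddCommGroup.toIsTopologicalAddGroup.toContinuousAdd
  (Submodule.span ℝ {T | ∃ x y, T = injTensorElem x y}).topologicalClosure

/-- The injective tensor product `X ⊗̂_ε Y` as a Banach space. -/
def InjectiveTensorSpace (X Y : Type*) [NormedAddCommGroup X] [NormedSpace ℝ X]
    [NormedAddCommGroup Y] [NormedSpace ℝ Y] : Type _ :=
  ↥(InjectiveTensorProduct X Y)

noncomputable instance {X Y : Type*} [NormedAddCommGroup X] [NormedSpace ℝ X]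
    [NormedAddCommGroup Y] [NormedSpace ℝ Y] : NormedAddCommGroup (InjectiveTensorSpace X Y) :=
  (Submodule.normedAddCommGroup (𝕜 := ℝ) (E := StrongDual ℝ X →L[ℝ] Y)
    (InjectiveTensorProduct X Y) :)

noncomputable instance {X Y : Type*} [NormedAddCommGroup X] [NormedSpace ℝ X]
    [NormedAddCommGroup Y] [NormedSpace ℝ Y] : NormedSpace ℝ (InjectiveTensorSpace X Y) :=
  (Submodule.normedSpace (𝕜 := ℝ) (R := ℝ) (E := StrongDual ℝ X →L[ℝ] Y)
    (InjectiveTensorProduct X Y) :)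

end


namespace BDPProof

variable {X Y : Type*} [NormedAddCommGroup X] [NormedSpace ℝ X]
  [NormedAddCommGroup Y] [NormedSpace ℝ Y]

/-- elementary tensor -/
noncomputable def tens (x : X) (y : Y) : ProjectiveTensorSpace X Y :=
  ⟨projTensorElem x y, Submodule.le_topologicalClosure _ (Submodule.subset_span ⟨x, y, rfl⟩)⟩

/-- evaluation at a bilinear form -/
noncomputable def pev (B : X →L[ℝ] Y →L[ℝ] ℝ) : StrongDual ℝ (ProjectiveTensorSpace X Y) :=
  (ContinuousLinearMap.apply ℝ ℝ (show BoundedBilinearForms X Y from B)).comp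
    (ProjectiveTensorProduct X Y).subtypeL

theorem pev_apply (B : X →L[ℝ] Y →L[ℝ] ℝ) (z : ProjectiveTensorSpace X Y) :
    pev B z = (Subtype.val z : StrongDual ℝ (BoundedBilinearForms X Y)) B := rfl

theorem pev_tens (B : X →L[ℝ] Y →L[ℝ] ℝ) (x : X) (y : Y) : pev B (tens x y) = B x y := rfl

theorem pev_le (B : X →L[ℝ] Y →L[ℝ] ℝ) (z : ProjectiveTensorSpace X Y) :
    |pev B z| ≤ ‖B‖ * ‖z‖ := by
  have := (Subtype.val z : StrongDual ℝ (BoundedBilinearForms X Y)).le_opNorm B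
  rw [mul_comm]
  exact this

theorem pev_add_smul (B C : X →L[ℝ] Y →L[ℝ] ℝ) (M : ℝ) (z : ProjectiveTensorSpace X Y) :
    pev (B + M • C) z = pev B z + M * pev C z := by
  have h1 := (Subtype.val z : StrongDual ℝ (BoundedBilinearForms X Y)).map_add B
    ((M • (show BoundedBilinearForms X Y from C) : BoundedBilinearForms X Y))
  have h2 := (Subtype.val z : StrongDual ℝ (BoundedBilinearForms X Y)).map_smul M
    (show BoundedBilinearForms X Y from C)
  rw [h2] at h1
  exact h1

theorem norm_le_of_pev (z : ProjectiveTensorSpace X Y) {C : ℝ} (hC : 0 ≤ C)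
    (h : ∀ B : X →L[ℝ] Y →L[ℝ] ℝ, ‖B‖ = 1 → |pev B z| ≤ C) : ‖z‖ ≤ C := by
  have := ContinuousLinearMap.opNorm_le_of_unit_norm
    (f := (Subtype.val z : StrongDual ℝ (BoundedBilinearForms X Y))) hC (fun B hB => h B hB)
  exact this

theorem norm_tens_le (x : X) (y : Y) : ‖tens x y‖ ≤ ‖x‖ * ‖y‖ := by
  refine norm_le_of_pev _ (by positivity) fun B hB => ?_
  rw [pev_tens]
  have := B.le_opNorm₂ x y
  rwa [hB, one_mul] at this

/-- rank one form -/
noncomputable def rk (f : StrongDual ℝ X) (g : StrongDual ℝ Y) : X →L[ℝ] Y →L[ℝ] ℝ :=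
  f.smulRight g

theorem rk_apply (f : StrongDual ℝ X) (g : StrongDual ℝ Y) (x : X) (y : Y) :
    rk f g x y = f x * g y := by simp [rk]

theorem norm_rk (f : StrongDual ℝ X) (g : StrongDual ℝ Y) : ‖rk f g‖ = ‖f‖ * ‖g‖ := by
  simp [rk]

theorem norm_tens (x : X) (y : Y) : ‖tens x y‖ = ‖x‖ * ‖y‖ := by
  refine le_antisymm (norm_tens_le x y) ?_
  obtain ⟨f, hf, hfx⟩ := exists_dual_vector'' ℝ x
  obtain ⟨g, hg, hgy⟩ := exists_dual_vector'' ℝ y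
  have h := pev_le (rk f g) (tens x y)
  rw [pev_tens, rk_apply, norm_rk, hfx, hgy] at h
  have h2 : ‖f‖ * ‖g‖ ≤ 1 := mul_le_one₀ hf (norm_nonneg _) hg
  have h3 := mul_le_mul_of_nonneg_right h2 (norm_nonneg (tens x y))
  calc ‖x‖ * ‖y‖ ≤ |‖x‖ * ‖y‖| := le_abs_self _
    _ ≤ _ := h
    _ ≤ _ := by simpa using h3

theorem ext_pev {z w : ProjectiveTensorSpace X Y} (h : ∀ B : X →L[ℝ] Y →L[ℝ] ℝ, pev B z = pev B w) :
    z = w := by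
  rw [← sub_eq_zero, ← norm_le_zero_iff]
  refine norm_le_of_pev _ le_rfl fun B _ => ?_
  rw [map_sub, h B]; simp

theorem tens_add_left (x x' : X) (y : Y) : tens (x + x') y = tens x y + tens x' y :=
  ext_pev fun B => by simp [pev_tens]
theorem tens_add_right (x : X) (y y' : Y) : tens x (y + y') = tens x y + tens x y' :=
  ext_pev fun B => by simp [pev_tens]
theorem tens_smul_left (c : ℝ) (x : X) (y : Y) : tens (c • x) y = c • tens x y :=
  ext_pev fun B => by simp [pev_tens]
theorem tens_smul_right (c : ℝ) (x : X) (y : Y) : tens x (c • y) = c • tens x y :=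
  ext_pev fun B => by simp [pev_tens]
theorem tens_sub_left (x x' : X) (y : Y) : tens (x - x') y = tens x y - tens x' y :=
  ext_pev fun B => by simp [pev_tens]
theorem tens_sub_right (x : X) (y y' : Y) : tens x (y - y') = tens x y - tens x y' :=
  ext_pev fun B => by simp [pev_tens]

theorem eq_of_tens (F G : StrongDual ℝ (ProjectiveTensorSpace X Y))
    (h : ∀ x y, F (tens x y) = G (tens x y)) : F = G := by
  ext z
  obtain ⟨z, hz⟩ := z
  have key : ∀ (w : StrongDual ℝ (BoundedBilinearForms X Y))
      (hw : w ∈ Submodule.span ℝ {φ | ∃ x y, φ = projTensorElem (X := X) (Y := Y) x y}),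
      F ⟨w, Submodule.le_topologicalClosure _ hw⟩ = G ⟨w, Submodule.le_topologicalClosure _ hw⟩ := by
    intro w hw
    induction hw using Submodule.span_induction with
    | mem w hw => obtain ⟨x, y, rfl⟩ := hw; exact h x y
    | zero => exact (F.map_zero).trans (G.map_zero).symm
    | add u v hu hv h1 h2 =>
      exact (F.map_add _ _).trans ((congrArg₂ (· + ·) h1 h2).trans (G.map_add _ _).symm)
    | smul c u hu h1 =>
      exact (F.map_smul c _).trans ((congrArg (c • ·) h1).trans (G.map_smul c _).symm)
  have hz' : z ∈ closure ((Submodule.span ℝ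
      {φ | ∃ x y, φ = projTensorElem (X := X) (Y := Y) x y} : Submodule ℝ _) : Set _) := hz
  obtain ⟨u, hu, hlim⟩ := mem_closure_iff_seq_limit.1 hz'
  have hlim' : Tendsto (fun n => (⟨u n, Submodule.le_topologicalClosure _ (hu n)⟩ :
      ProjectiveTensorSpace X Y)) atTop (nhds ⟨z, hz⟩) := tendsto_subtype_rng.2 hlim
  have hF := (F.continuous.tendsto _).comp hlim'
  have hG := (G.continuous.tendsto _).comp hlim'
  refine tendsto_nhds_unique hF (hG.congr fun n => ?_)
  exact (key _ (hu n)).symm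

theorem exists_pev (F : StrongDual ℝ (ProjectiveTensorSpace X Y)) :
    ∃ B : X →L[ℝ] Y →L[ℝ] ℝ, F = pev B ∧ ‖B‖ ≤ ‖F‖ := by
  let L : X →ₗ[ℝ] Y →ₗ[ℝ] ℝ := LinearMap.mk₂ ℝ (fun x y => F (tens x y))
    (fun x x' y => by rw [tens_add_left, map_add])
    (fun c x y => by rw [tens_smul_left, map_smul])
    (fun x y y' => by rw [tens_add_right, map_add])
    (fun c x y => by rw [tens_smul_right, map_smul])
  have hb : ∀ x y, ‖L x y‖ ≤ ‖F‖ * ‖x‖ * ‖y‖ := fun x y => by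
    have := F.le_opNorm (tens x y)
    rw [norm_tens, ← mul_assoc] at this
    exact this
  refine ⟨L.mkContinuous₂ ‖F‖ hb, eq_of_tens _ _ fun x y => ?_,
    L.mkContinuous₂_norm_le (norm_nonneg F) hb⟩
  rfl

theorem exists_near {Z : Type*} [NormedAddCommGroup Z] [NormedSpace ℝ Z] (f : StrongDual ℝ Z)
    {c : ℝ} (hc : c < ‖f‖) : ∃ x, ‖x‖ ≤ 1 ∧ c < f x := by
  obtain ⟨x, hx, h⟩ := f.exists_lt_apply_of_lt_opNorm hc
  rw [Real.norm_eq_abs] at h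
  rcases lt_abs.1 h with h | h
  · exact ⟨x, hx.le, h⟩
  · exact ⟨-x, by simpa using hx.le, by simpa using h⟩

theorem bdd_slice {Z : Type*} [NormedAddCommGroup Z] [NormedSpace ℝ Z] (f : StrongDual ℝ Z)
    (c : ℝ) : Bornology.IsBounded {z : Z | ‖z‖ ≤ 1 ∧ c < f z} :=
  (Metric.isBounded_closedBall (x := (0 : Z)) (r := 1)).subset fun z hz => by simpa using hz.1

/-- transfer of small slices along an isometric embedding -/
theorem transfer {Z W : Type*} [NormedAddCommGroup Z] [NormedSpace ℝ Z]
    [NormedAddCommGroup W] [NormedSpace ℝ W] (F : StrongDual ℝ Z) (α ε : ℝ) (hα1 : α < 1)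
    (hd : Metric.diam {z : Z | ‖z‖ ≤ 1 ∧ 1 - α < F z} < ε)
    (f : StrongDual ℝ W) (hf : ‖f‖ ≤ 1) (T : W → Z) (hT : Isometry T) (hT0 : ∀ w, ‖T w‖ = ‖w‖)
    (hTF : ∀ w, F (T w) = f w) (w : W) (hw : ‖w‖ ≤ 1) (hfw : 1 - α < f w) (hα : 0 < α) :
    ∃ (f : StrongDual ℝ W) (α : ℝ), ‖f‖ = 1 ∧ 0 < α ∧ α < 1 ∧
      Metric.diam {z : W | ‖z‖ ≤ 1 ∧ 1 - α < f z} < ε := by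
  have hfn : 1 - α < ‖f‖ := by
    have h1 := f.le_opNorm w
    have h2 := le_abs_self (f w)
    rw [Real.norm_eq_abs] at h1
    nlinarith [norm_nonneg f]
  have hpos : 0 < ‖f‖ := by linarith
  refine ⟨‖f‖⁻¹ • f, 1 - (1 - α) / ‖f‖, ?_, ?_, ?_, ?_⟩
  · rw [norm_smul, norm_inv, norm_norm, inv_mul_cancel₀ hpos.ne']
  · have : (1 - α) / ‖f‖ < 1 := (div_lt_one hpos).2 hfn
    linarith
  · have : 0 < (1 - α) / ‖f‖ := div_pos (by linarith) hpos
    linarith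
  · refine lt_of_le_of_lt ?_ hd
    rw [← hT.diam_image]
    refine Metric.diam_mono ?_ (bdd_slice F _)
    rintro _ ⟨v, ⟨hv1, hv2⟩, rfl⟩
    refine ⟨(hT0 v).trans_le hv1, ?_⟩
    rw [hTF]
    have : (1 - α) / ‖f‖ < f v / ‖f‖ := by
      have e : (‖f‖⁻¹ • f) v = f v / ‖f‖ := by simp [div_eq_inv_mul]
      rw [e] at hv2; linarith
    exact (div_lt_div_iff_of_pos_right hpos).1 this

theorem exists_unit (B : X →L[ℝ] Y →L[ℝ] ℝ) {c : ℝ} (hc0 : 0 ≤ c) (hc : c < ‖B‖) :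
    ∃ x y, ‖x‖ = 1 ∧ ‖y‖ = 1 ∧ c < B x y := by
  obtain ⟨x, hx, h⟩ := B.exists_lt_apply_of_lt_opNorm hc
  obtain ⟨y, hy, h⟩ := exists_near (B x) h
  have hx0 : x ≠ 0 := by rintro rfl; simp at h; linarith
  have hy0 : y ≠ 0 := by rintro rfl; simp at h; linarith
  have hxp : 0 < ‖x‖ := norm_pos_iff.2 hx0
  have hyp : 0 < ‖y‖ := norm_pos_iff.2 hy0
  refine ⟨‖x‖⁻¹ • x, ‖y‖⁻¹ • y, ?_, ?_, ?_⟩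
  · rw [norm_smul, norm_inv, norm_norm, inv_mul_cancel₀ hxp.ne']
  · rw [norm_smul, norm_inv, norm_norm, inv_mul_cancel₀ hyp.ne']
  · have e : B (‖x‖⁻¹ • x) (‖y‖⁻¹ • y) = ‖x‖⁻¹ * (‖y‖⁻¹ * B x y) := by
      simp; ring
    rw [e]
    have h1 : 1 ≤ ‖x‖⁻¹ := (one_le_inv₀ hxp).2 hx.le
    have h2 : 1 ≤ ‖y‖⁻¹ := (one_le_inv₀ hyp).2 hy
    have h3 : 0 < B x y := by linarith
    have h4 : B x y ≤ ‖y‖⁻¹ * B x y := le_mul_of_one_le_left h3.le h2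
    have h5 : ‖y‖⁻¹ * B x y ≤ ‖x‖⁻¹ * (‖y‖⁻¹ * B x y) :=
      le_mul_of_one_le_left (by linarith) h1
    linarith

theorem norm_eq_of_pev (B : X →L[ℝ] Y →L[ℝ] ℝ) : ‖pev B‖ ≤ ‖B‖ :=
  ContinuousLinearMap.opNorm_le_bound _ B.opNorm_nonneg fun z => pev_le B z

theorem le_norm_pev (B : X →L[ℝ] Y →L[ℝ] ℝ) : ‖B‖ ≤ ‖pev B‖ := by
  refine ContinuousLinearMap.opNorm_le_bound₂ _ (norm_nonneg _) fun x y => ?_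
  have := (pev B).le_opNorm (tens x y)
  rw [norm_tens, ← mul_assoc, pev_tens] at this
  exact this

theorem forward (h : BallDentableProperty (ProjectiveTensorSpace X Y)) :
    BallDentableProperty X ∧ BallDentableProperty Y := by
  have main : ∀ ε : ℝ, 0 < ε → ∃ (B : X →L[ℝ] Y →L[ℝ] ℝ) (α : ℝ) (x : X) (y : Y), 0 < α ∧ α < 1 ∧
      Metric.diam {z | ‖z‖ ≤ 1 ∧ 1 - α < pev B z} < ε ∧ ‖B‖ = 1 ∧ ‖x‖ = 1 ∧ ‖y‖ = 1 ∧
      1 - α < B x y := by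
    intro ε hε
    obtain ⟨F, α, hF, hα, hα1, hd⟩ := h ε hε
    obtain ⟨B, rfl, hB⟩ := exists_pev F
    have hB1 : ‖B‖ = 1 := le_antisymm (hB.trans hF.le) (hF.ge.trans (norm_eq_of_pev B))
    obtain ⟨x, y, hx, hy, hxy⟩ := exists_unit B (c := 1 - α) (by linarith) (by linarith)
    exact ⟨B, α, x, y, hα, hα1, hd, hB1, hx, hy, hxy⟩
  constructor
  · intro ε hε
    obtain ⟨B, α, x, y, hα, hα1, hd, hB1, hx, hy, hxy⟩ := main ε hε
    refine transfer (pev B) α ε hα1 hd (B.flip y) ?_ (fun x => tens x y) ?_ ?_ ?_ x hx.le hxy hα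
    · have := B.flip.le_opNorm y
      rwa [B.opNorm_flip, hB1, hy, mul_one] at this
    · refine Isometry.of_dist_eq fun a b => ?_
      rw [dist_eq_norm, dist_eq_norm, ← tens_sub_left, norm_tens, hy, mul_one]
    · intro w; rw [norm_tens, hy, mul_one]
    · intro w; rw [pev_tens]; rfl
  · intro ε hε
    obtain ⟨B, α, x, y, hα, hα1, hd, hB1, hx, hy, hxy⟩ := main ε hε
    refine transfer (pev B) α ε hα1 hd (B x) ?_ (fun y => tens x y) ?_ ?_ ?_ y hy.le hxy hα
    · have := B.le_opNorm x
      rwa [hB1, hx, mul_one] at this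
    · refine Isometry.of_dist_eq fun a b => ?_
      rw [dist_eq_norm, dist_eq_norm, ← tens_sub_right, norm_tens, hx, one_mul]
    · intro w; rw [norm_tens, hx, one_mul]
    · intro w; rw [pev_tens]

/-- The sign-normalised pointwise estimate. -/
theorem near_pos (f : StrongDual ℝ X) (g : StrongDual ℝ Y) (hf : ‖f‖ = 1) (hg : ‖g‖ = 1)
    (x0 : X) (y0 : Y) (hx0 : ‖x0‖ ≤ 1) {δ e : ℝ} (hδ1 : δ < 1)
    (hX : ∀ x, ‖x‖ ≤ 1 → 1 - δ < f x → ‖x - x0‖ ≤ e)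
    (hY : ∀ y, ‖y‖ ≤ 1 → 1 - δ < g y → ‖y - y0‖ ≤ e)
    (B : X →L[ℝ] Y →L[ℝ] ℝ) (hB : ‖B‖ = 1) (x : X) (y : Y) (hx : ‖x‖ ≤ 1) (hy : ‖y‖ ≤ 1)
    (h : 1 - δ < f x * g y) : B x y ≤ B x0 y0 + 2 * e := by
  have pos : ∀ (x : X) (y : Y), ‖x‖ ≤ 1 → ‖y‖ ≤ 1 → 1 - δ < f x * g y → 0 < f x →
      B x y ≤ B x0 y0 + 2 * e := by
    intro x y hx hy h hfx
    have h1 : f x ≤ 1 := by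
      have := f.le_opNorm x
      rw [hf, one_mul] at this
      exact (le_abs_self _).trans (this.trans hx)
    have h2 : g y ≤ 1 := by
      have := g.le_opNorm y
      rw [hg, one_mul] at this
      exact (le_abs_self _).trans (this.trans hy)
    have hgy : 0 < g y := by
      by_contra hn
      nlinarith
    have a1 := hX x hx (by nlinarith)
    have a2 := hY y hy (by nlinarith)
    have e1 : B x y - B x0 y0 = B (x - x0) y + B x0 (y - y0) := by simp
    have b1 := (le_abs_self _).trans (B.le_opNorm₂ (x - x0) y)
    have b2 := (le_abs_self _).trans (B.le_opNorm₂ x0 (y - y0))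
    rw [hB, one_mul] at b1 b2
    have c1 : ‖x - x0‖ * ‖y‖ ≤ ‖x - x0‖ := mul_le_of_le_one_right (norm_nonneg _) hy
    have c2 : ‖x0‖ * ‖y - y0‖ ≤ ‖y - y0‖ := mul_le_of_le_one_left (norm_nonneg _) hx0
    linarith
  rcases lt_trichotomy (f x) 0 with hn | hn | hn
  · have := pos (-x) (-y) (by simpa using hx) (by simpa using hy) (by simpa using h) (by simpa using hn)
    simpa using this
  · rw [hn] at h; linarith
  · exact pos x y hx hy h hn

theorem near_tens (f : StrongDual ℝ X) (g : StrongDual ℝ Y) (hf : ‖f‖ = 1) (hg : ‖g‖ = 1)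
    (x0 : X) (y0 : Y) (hx0 : ‖x0‖ ≤ 1) (hy0 : ‖y0‖ ≤ 1) {δ e : ℝ} (hδ : 0 < δ) (hδ1 : δ < 1)
    (he : 0 ≤ e)
    (hX : ∀ x, ‖x‖ ≤ 1 → 1 - δ < f x → ‖x - x0‖ ≤ e)
    (hY : ∀ y, ‖y‖ ≤ 1 → 1 - δ < g y → ‖y - y0‖ ≤ e)
    (z : ProjectiveTensorSpace X Y) (hz : ‖z‖ ≤ 1) (hfz : 1 - δ * e / 2 < pev (rk f g) z) :
    ‖z - tens x0 y0‖ ≤ 3 * e := by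
  have main : ∀ B : X →L[ℝ] Y →L[ℝ] ℝ, ‖B‖ = 1 → pev B (z - tens x0 y0) ≤ 3 * e := by
    intro B hB
    have hBle : ∀ x y, ‖x‖ ≤ 1 → ‖y‖ ≤ 1 → |B x y| ≤ 1 := by
      intro x y hx hy
      have := B.le_opNorm₂ x y
      rw [hB, one_mul] at this
      exact this.trans (mul_le_one₀ hx (norm_nonneg _) hy)
    have hB0 := abs_le.1 (hBle x0 y0 hx0 hy0)
    set M : ℝ := 2 / δ with hM
    have hMδ : M * δ = 2 := by rw [hM]; field_simp
    have hMp : 2 < M := by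
      have : 0 < M := by positivity
      nlinarith
    have bound : ∀ x y, ‖x‖ ≤ 1 → ‖y‖ ≤ 1 →
        (B + M • rk f g) x y ≤ M + B x0 y0 + 2 * e := by
      intro x y hx hy
      have ev : (B + M • rk f g) x y = B x y + M * (f x * g y) := by simp [rk_apply]
      rw [ev]
      have hb := abs_le.1 (hBle x y hx hy)
      by_cases h : 1 - δ < f x * g y
      · have h1 := near_pos f g hf hg x0 y0 hx0 hδ1 hX hY B hB x y hx hy h
        have h2 : f x * g y ≤ 1 := by
          have := (rk f g).le_opNorm₂ x y
          rw [norm_rk, hf, hg, rk_apply, one_mul, one_mul] at this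
          exact (le_abs_self _).trans (this.trans (mul_le_one₀ hx (norm_nonneg _) hy))
        nlinarith
      · have : M * (f x * g y) ≤ M * (1 - δ) :=
          mul_le_mul_of_nonneg_left (not_lt.1 h) (by linarith)
        nlinarith
    have hG : ‖B + M • rk f g‖ ≤ M + B x0 y0 + 2 * e := by
      by_contra hn
      obtain ⟨x, y, hx, hy, hxy⟩ := exists_unit _ (by linarith) (not_le.1 hn)
      exact absurd (bound x y hx.le hy.le) (not_le.2 hxy)
    have h1 := (le_abs_self _).trans (pev_le (B + M • rk f g) z)
    rw [pev_add_smul] at h1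
    have h2 : ‖B + M • rk f g‖ * ‖z‖ ≤ ‖B + M • rk f g‖ :=
      mul_le_of_le_one_right (ContinuousLinearMap.opNorm_nonneg _) hz
    rw [map_sub, pev_tens]
    have h3 : M * (1 - δ * e / 2) ≤ M * pev (rk f g) z :=
      mul_le_mul_of_nonneg_left hfz.le (by linarith)
    have h4 : M * (1 - δ * e / 2) = M - e := by
      calc M * (1 - δ * e / 2) = M - (M * δ) * e / 2 := by ring
        _ = _ := by rw [hMδ]; ring
    linarith
  refine norm_le_of_pev _ (by linarith) fun B hB => abs_le.2 ⟨?_, main B hB⟩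
  have h := main (-B) ((ContinuousLinearMap.opNorm_neg B).trans hB)
  have e1 : pev (-B) (z - tens x0 y0) = - pev B (z - tens x0 y0) := by
    exact (Subtype.val (z - tens x0 y0) : StrongDual ℝ (BoundedBilinearForms X Y)).map_neg B
  linarith

theorem backward (hX : BallDentableProperty X) (hY : BallDentableProperty Y) :
    BallDentableProperty (ProjectiveTensorSpace X Y) := by
  intro ε hε
  set e : ℝ := min (ε / 7) 1 with he
  have he0 : 0 < e := lt_min (by linarith) one_pos
  have he1 : e ≤ 1 := min_le_right _ _
  have heε : e ≤ ε / 7 := min_le_left _ _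
  obtain ⟨f, α, hf, hα, hα1, hdf⟩ := hX e he0
  obtain ⟨g, β, hg, hβ, hβ1, hdg⟩ := hY e he0
  obtain ⟨x0, hx0, hfx0⟩ := exists_near f (c := 1 - α) (by linarith)
  obtain ⟨y0, hy0, hgy0⟩ := exists_near g (c := 1 - β) (by linarith)
  set δ := min α β with hδ
  have hδ0 : 0 < δ := lt_min hα hβ
  have hδα : δ ≤ α := min_le_left _ _
  have hδβ : δ ≤ β := min_le_right _ _
  have hX' : ∀ x, ‖x‖ ≤ 1 → 1 - δ < f x → ‖x - x0‖ ≤ e := fun x hx h => by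
    rw [← dist_eq_norm]
    exact (Metric.dist_le_diam_of_mem (bdd_slice f (1 - α)) ⟨hx, by linarith⟩ ⟨hx0, hfx0⟩).trans hdf.le
  have hY' : ∀ y, ‖y‖ ≤ 1 → 1 - δ < g y → ‖y - y0‖ ≤ e := fun y hy h => by
    rw [← dist_eq_norm]
    exact (Metric.dist_le_diam_of_mem (bdd_slice g (1 - β)) ⟨hy, by linarith⟩ ⟨hy0, hgy0⟩).trans hdg.le
  have hn : ‖rk f g‖ = 1 := by rw [norm_rk, hf, hg, one_mul]
  refine ⟨pev (rk f g), δ * e / 2, le_antisymm ((norm_eq_of_pev _).trans hn.le)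
    (hn.ge.trans (le_norm_pev _)), by positivity, by nlinarith, ?_⟩
  refine lt_of_le_of_lt (Metric.diam_le_of_forall_dist_le (C := 6 * e) (by linarith) ?_)
    (by linarith)
  rintro z ⟨hz, hfz⟩ w ⟨hw, hfw⟩
  have h1 := near_tens f g hf hg x0 y0 hx0 hy0 hδ0 (by linarith) he0.le hX' hY' z hz hfz
  have h2 := near_tens f g hf hg x0 y0 hx0 hy0 hδ0 (by linarith) he0.le hX' hY' w hw hfw
  rw [← dist_eq_norm] at h1 h2
  have := dist_triangle_right z w (tens x0 y0)
  linarith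

end BDPProof

/-- Corollary 2.8: the projective tensor product `X ⊗̂_π Y` has the Ball Dentable
Property if and only if both `X` and `Y` have the Ball Dentable Property. -/
theorem statement5 {X Y : Type*} [NormedAddCommGroup X] [NormedSpace ℝ X] [CompleteSpace X]
    [NormedAddCommGroup Y] [NormedSpace ℝ Y] [CompleteSpace Y] :
    BallDentableProperty (ProjectiveTensorSpace X Y) ↔
      BallDentableProperty X ∧ BallDentableProperty Y := by
  exact ⟨BDPProof.forward, fun h => BDPProof.backward h.1 h.2⟩
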